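/- (Passive minimax lower bound, general k, large noise.) Fix real k > 1, constants 0 < c < C with C ≤ 1, and ε₀ ∈ (0, 1/2). There exist constants κ₀ > 0, κ₁ > 0, and ρ ∈ (0, 1/2), depending only on c, C, k and ε₀, such that for every integer n ≥ 1, every σ with κ₀ · n^{−1/(2k−1)} ≤ σ ≤ ρ, and every measurable estimator t̂ : ([−1+σ, 1−σ] × {0,1})^n → ℝ, one has sup_{m ∈ 𝒫(c,C,k,σ)} E_{ν_m^{⊗n}} |t̂ − t(m)| ≥ κ₁ · σ^{−(k−3/2)} · n^{−1/2}, where the expectation is over n i.i.d. samples (W_i, Y_i) from ν_m. -/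

import Mathlib

open MeasureTheory Real
open scoped ENNReal

/-- Uniform-noise convolution: `(g ⋆ U_σ)(w) = (1/(2σ)) ∫_{w-σ}^{w+σ} g(x) dx`. -/
noncomputable def unifConv (σ : ℝ) (g : ℝ → ℝ) (w : ℝ) : ℝ :=
  (1 / (2 * σ)) * ∫ x in (w - σ)..(w + σ), g x

/-- The Bernoulli measure with parameter `p` on `Bool`. -/
noncomputable def bern (p : ℝ) : Measure Bool :=
  ENNReal.ofReal p • Measure.dirac true + ENNReal.ofReal (1 - p) • Measure.dirac false

/-- The law of a passive sample `(W, Y)` where `W` is uniform on `[a, b]` and,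
conditionally on `W = w`, `Y` is `Bernoulli(F(w))`. -/
noncomputable def sampleLawOn (a b : ℝ) (F : ℝ → ℝ) : Measure (ℝ × Bool) :=
  ((ENNReal.ofReal (b - a))⁻¹ • (volume.restrict (Set.Icc a b))).bind
    (fun w => (bern (F w)).map (Prod.mk w))

/-- Membership of a regression function `m` with threshold `t` in the class
`𝒫(c, C, k, σ)` (with margin-condition window `ε₀`): `m` is measurable, `[0,1]`-valued
on `[-1,1]`, has a threshold `t ∈ [-1+σ, 1-σ]`, satisfies Tsybakov's two-sided margin
condition (T) with exponent `k-1`, and is antisymmetric (M) on `[t-σ, t+σ]`. -/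
def memClass (c C k σ ε₀ : ℝ) (m : ℝ → ℝ) (t : ℝ) : Prop :=
  Measurable m ∧ (∀ x ∈ Set.Icc (-1 : ℝ) 1, m x ∈ Set.Icc (0 : ℝ) 1) ∧
  t ∈ Set.Icc (-1 + σ) (1 - σ) ∧
  (∀ x ∈ Set.Icc (-1 : ℝ) 1, x < t → m x < 1 / 2) ∧
  (∀ x ∈ Set.Icc (-1 : ℝ) 1, t < x → 1 / 2 < m x) ∧
  (∀ x ∈ Set.Icc (-1 : ℝ) 1, |m x - 1 / 2| ≤ ε₀ →
    c * |x - t| ^ (k - 1) ≤ |m x - 1 / 2| ∧ |m x - 1 / 2| ≤ C * |x - t| ^ (k - 1)) ∧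
  (∀ δ ∈ Set.Icc (0 : ℝ) σ, m (t + δ) - 1 / 2 = 1 / 2 - m (t - δ))

theorem lintegral_pi_prod_eq_prod {Ω : Type*} [MeasurableSpace Ω] (P : Measure Ω)
    [IsProbabilityMeasure P] {n : ℕ} (f : Fin n → Ω → ℝ≥0∞) (hf : ∀ i, Measurable (f i)) :
    ∫⁻ x, ∏ i, f i (x i) ∂(Measure.pi fun _ : Fin n => P) = ∏ i, ∫⁻ y, f i y ∂P := by
  have hind : ProbabilityTheory.iIndepFun (fun i (x : Fin n → Ω) => f i (x i))
      (Measure.pi fun _ : Fin n => P) :=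
    ProbabilityTheory.iIndepFun_pi (fun i => (hf i).aemeasurable)
  rw [ProbabilityTheory.lintegral_prod_eq_prod_lintegral_of_indepFun Finset.univ _ hind
    (fun i => (hf i).comp (measurable_pi_apply i))]
  refine Finset.prod_congr rfl fun i _ => ?_
  exact (measurePreserving_eval (fun _ : Fin n => P) i).lintegral_comp (hf i)

theorem pi_withDensity_eq {Ω : Type*} [MeasurableSpace Ω] (P Q : Measure Ω)
    [IsProbabilityMeasure P] [IsProbabilityMeasure Q] {r : Ω → ℝ≥0∞} (hr : Measurable r)
    (hQ : Q = P.withDensity r) (n : ℕ) :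
    (Measure.pi fun _ : Fin n => Q) =
      (Measure.pi fun _ : Fin n => P).withDensity fun x => ∏ i, r (x i) := by
  refine (Measure.pi_eq fun s hs => ?_)
  rw [withDensity_apply _ (MeasurableSet.univ_pi hs),
    ← lintegral_indicator (MeasurableSet.univ_pi hs)]
  have : (Set.univ.pi s).indicator (fun x : Fin n → Ω => ∏ i, r (x i)) =
      fun x => ∏ i, (s i).indicator r (x i) := by
    ext x
    by_cases hx : x ∈ Set.univ.pi s
    · rw [Set.indicator_of_mem hx]
      exact Finset.prod_congr rfl fun i _ => (Set.indicator_of_mem (hx i trivial) r).symm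
    · rw [Set.indicator_of_notMem hx]
      simp only [Set.mem_pi, Set.mem_univ, true_implies, not_forall] at hx
      obtain ⟨i, hi⟩ := hx
      exact (Finset.prod_eq_zero (Finset.mem_univ i) (Set.indicator_of_notMem hi r)).symm
  rw [this, lintegral_pi_prod_eq_prod P _ fun i => hr.indicator (hs i)]
  refine Finset.prod_congr rfl fun i _ => ?_
  rw [hQ, withDensity_apply _ (hs i), lintegral_indicator (hs i)]

theorem half_le_lintegral_min_one {Ω : Type*} [MeasurableSpace Ω] (P : Measure Ω)
    {L : Ω → ℝ≥0∞} (hL : Measurable L) (h1 : ∫⁻ x, L x ∂P = 1)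
    (h2 : ∫⁻ x, L x ^ 2 ∂P ≤ 2) : 1 / 2 ≤ ∫⁻ x, min 1 (L x) ∂P := by
  have key : ∀ y : ℝ≥0∞, y ≤ min 1 y + 4⁻¹ * y ^ 2 := by
    intro y
    induction y with
    | top => simp
    | coe y =>
      rcases le_total (1 : ℝ≥0∞) y with hy | hy
      · rw [min_eq_left hy]
        have : (4 : ℝ≥0∞)⁻¹ = ((4⁻¹ : NNReal) : ℝ≥0∞) := by
          rw [ENNReal.coe_inv (by norm_num)]; rfl
        rw [this]
        norm_cast
        rw [← NNReal.coe_le_coe]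
        push_cast
        nlinarith [sq_nonneg ((y : ℝ) - 2)]
      · rw [min_eq_right hy]
        exact le_self_add
  have h3 : (1 : ℝ≥0∞) ≤ ∫⁻ x, min 1 (L x) ∂P + 1 / 2 := by
    calc (1 : ℝ≥0∞) = ∫⁻ x, L x ∂P := h1.symm
      _ ≤ ∫⁻ x, (min 1 (L x) + 4⁻¹ * L x ^ 2) ∂P := lintegral_mono fun x => key _
      _ = ∫⁻ x, min 1 (L x) ∂P + 4⁻¹ * ∫⁻ x, L x ^ 2 ∂P := by
        rw [lintegral_add_left (measurable_const.min hL),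
          lintegral_const_mul _ (hL.pow_const 2)]
      _ ≤ ∫⁻ x, min 1 (L x) ∂P + 4⁻¹ * 2 := by gcongr
      _ = _ := by
        congr 1
        rw [← ENNReal.toReal_eq_toReal_iff' (by finiteness) (by finiteness)]
        norm_num
  exact (ENNReal.add_le_add_iff_right (by finiteness)).1 ((ENNReal.add_halves 1).le.trans h3)

/-- Le Cam's two-point bound under a chi-square condition. -/
theorem two_point_lower_bound {Ω : Type*} [MeasurableSpace Ω] (P Q : Measure Ω)
    [IsProbabilityMeasure P] [IsProbabilityMeasure Q] {r : Ω → ℝ≥0∞} (hr : Measurable r)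
    (hQ : Q = P.withDensity r) (n : ℕ) (h2 : (∫⁻ x, r x ^ 2 ∂P) ^ n ≤ 2)
    {T : (Fin n → Ω) → ℝ} (hT : Measurable T) (s t : ℝ) :
    ENNReal.ofReal (|t - s| / 2) ≤
      ∫⁻ x, ENNReal.ofReal |T x - s| ∂(Measure.pi fun _ : Fin n => P) +
        ∫⁻ x, ENNReal.ofReal |T x - t| ∂(Measure.pi fun _ : Fin n => Q) := by
  have hLm : Measurable fun x : Fin n → Ω => ∏ i, r (x i) := by fun_prop
  have hTs : ∀ u : ℝ, Measurable fun x => ENNReal.ofReal |T x - u| := fun u => by fun_prop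
  have hmin := half_le_lintegral_min_one (Measure.pi fun _ : Fin n => P) hLm
    (by
      rw [lintegral_pi_prod_eq_prod P _ fun _ => hr]
      refine Finset.prod_eq_one fun i _ => ?_
      rw [← setLIntegral_univ, ← withDensity_apply _ MeasurableSet.univ, ← hQ, measure_univ])
    (by
      simp_rw [← Finset.prod_pow]
      rw [lintegral_pi_prod_eq_prod P _ fun _ => hr.pow_const 2]
      simpa using h2)
  rw [pi_withDensity_eq P Q hr hQ, lintegral_withDensity_eq_lintegral_mul _ hLm (hTs t),
    ← lintegral_add_left (hTs s)]
  calc ENNReal.ofReal (|t - s| / 2) = ENNReal.ofReal |t - s| * (1 / 2) := by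
        rw [ENNReal.ofReal_div_of_pos two_pos, div_eq_mul_one_div]; norm_num
    _ ≤ ENNReal.ofReal |t - s| * ∫⁻ x, min 1 (∏ i, r (x i)) ∂(Measure.pi fun _ : Fin n => P) := by
        gcongr
    _ = ∫⁻ x, ENNReal.ofReal |t - s| * min 1 (∏ i, r (x i)) ∂(Measure.pi fun _ : Fin n => P) :=
        (lintegral_const_mul _ (measurable_const.min hLm)).symm
    _ ≤ _ := by
        refine lintegral_mono fun x => ?_
        have htri : ENNReal.ofReal |t - s| ≤
            ENNReal.ofReal |T x - s| + ENNReal.ofReal |T x - t| := by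
          rw [← ENNReal.ofReal_add (abs_nonneg _) (abs_nonneg _)]
          refine ENNReal.ofReal_le_ofReal ?_
          have := abs_sub_le t (T x) s
          rw [abs_sub_comm t (T x)] at this
          linarith
        calc _ ≤ (ENNReal.ofReal |T x - s| + ENNReal.ofReal |T x - t|) *
              min 1 (∏ i, r (x i)) := by gcongr
          _ ≤ ENNReal.ofReal |T x - s| * 1 + ENNReal.ofReal |T x - t| * ∏ i, r (x i) := by
            rw [add_mul]
            gcongr
            · exact min_le_left _ _
            · exact min_le_right _ _
          _ = _ := by simp [mul_comm]

theorem measurable_bern_map {F : ℝ → ℝ} (hF : Measurable F) :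
    Measurable fun w => (bern (F w)).map (Prod.mk w) := by
  refine Measure.measurable_of_measurable_coe _ fun s hs => ?_
  have : (fun w => (bern (F w)).map (Prod.mk w) s) = fun w =>
      ENNReal.ofReal (F w) * s.indicator 1 (w, true) +
        ENNReal.ofReal (1 - F w) * s.indicator 1 (w, false) := by
    ext w
    rw [Measure.map_apply measurable_prodMk_left hs, bern]
    simp only [Measure.coe_add, Measure.coe_smul, Pi.add_apply, Pi.smul_apply, smul_eq_mul,
      Measure.dirac_apply' _ (measurable_prodMk_left hs)]
    rfl
  rw [this]
  have hi : Measurable (s.indicator (1 : ℝ × Bool → ℝ≥0∞)) := measurable_one.indicator hs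
  fun_prop

theorem lintegral_sampleLawOn {a b : ℝ} {F : ℝ → ℝ} (hF : Measurable F)
    {f : ℝ × Bool → ℝ≥0∞} (hf : Measurable f) :
    ∫⁻ z, f z ∂(sampleLawOn a b F) = (ENNReal.ofReal (b - a))⁻¹ *
      ∫⁻ w in Set.Icc a b, (ENNReal.ofReal (F w) * f (w, true) +
        ENNReal.ofReal (1 - F w) * f (w, false)) := by
  rw [sampleLawOn, Measure.lintegral_bind (measurable_bern_map hF).aemeasurable hf.aemeasurable,
    lintegral_smul_measure, smul_eq_mul]
  congr 1
  refine lintegral_congr fun w => ?_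
  rw [lintegral_map hf measurable_prodMk_left, bern, lintegral_add_measure,
    lintegral_smul_measure, lintegral_smul_measure, lintegral_dirac, lintegral_dirac]
  rfl

theorem isProbabilityMeasure_sampleLawOn {a b : ℝ} (hab : a < b) {F : ℝ → ℝ} (hF : Measurable F)
    (h01 : ∀ w, F w ∈ Set.Icc (0 : ℝ) 1) : IsProbabilityMeasure (sampleLawOn a b F) := by
  constructor
  rw [← lintegral_one, lintegral_sampleLawOn hF measurable_const]
  have : ∀ w, ENNReal.ofReal (F w) * 1 + ENNReal.ofReal (1 - F w) * 1 = 1 := fun w => by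
    simp only [mul_one]
    rw [← ENNReal.ofReal_add (h01 w).1 (sub_nonneg.2 (h01 w).2)]
    simp
  simp only [this, lintegral_one, Measure.restrict_apply MeasurableSet.univ, Set.univ_inter,
    Real.volume_Icc]
  exact ENNReal.inv_mul_cancel (by simpa using hab) (by finiteness)

/-- The likelihood ratio of `sampleLawOn a b G` against `sampleLawOn a b F`. -/
noncomputable def sampleRatio (F G : ℝ → ℝ) (z : ℝ × Bool) : ℝ≥0∞ :=
  if z.2 = true then ENNReal.ofReal (G z.1 / F z.1)
  else ENNReal.ofReal ((1 - G z.1) / (1 - F z.1))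

theorem measurable_sampleRatio {F G : ℝ → ℝ} (hF : Measurable F) (hG : Measurable G) :
    Measurable (sampleRatio F G) := by
  refine Measurable.ite (measurable_snd (measurableSet_singleton true)) ?_ ?_ <;> fun_prop

theorem sampleLawOn_eq_withDensity {a b : ℝ} {F G : ℝ → ℝ} (hF : Measurable F)
    (hG : Measurable G) (hF01 : ∀ w, F w ∈ Set.Ioo (0 : ℝ) 1) :
    sampleLawOn a b G = (sampleLawOn a b F).withDensity (sampleRatio F G) := by
  have hr := measurable_sampleRatio hF hG
  refine Measure.ext_of_lintegral _ fun f hf => ?_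
  rw [lintegral_withDensity_eq_lintegral_mul _ hr hf, lintegral_sampleLawOn hG hf,
    lintegral_sampleLawOn hF (hr.mul hf)]
  congr 1
  refine lintegral_congr fun w => ?_
  have h0 := (hF01 w).1
  have h1 : 0 < 1 - F w := sub_pos.2 (hF01 w).2
  simp only [Pi.mul_apply, sampleRatio, if_true, Bool.false_eq_true, if_false]
  rw [← mul_assoc, ← mul_assoc, ← ENNReal.ofReal_mul h0.le, ← ENNReal.ofReal_mul h1.le,
    mul_div_cancel₀ _ h0.ne', mul_div_cancel₀ _ h1.ne']

theorem lintegral_sampleRatio_sq_le {a b : ℝ} (hab : 1 ≤ b - a) {F G : ℝ → ℝ}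
    (hF : Measurable F) (hG : Measurable G) {q B u v : ℝ} (hq : 0 < q)
    (hF01 : ∀ w, F w ∈ Set.Ioo (0 : ℝ) 1) (hG01 : ∀ w, G w ∈ Set.Icc (0 : ℝ) 1)
    (hFq : ∀ w, q ≤ F w * (1 - F w))
    (hB : ∀ w, |G w - F w| ≤ B) (hout : ∀ w, w ∉ Set.Icc u v → G w = F w) :
    ∫⁻ z, sampleRatio F G z ^ 2 ∂(sampleLawOn a b F) ≤
      1 + ENNReal.ofReal (B ^ 2 / q * (v - u)) := by
  rw [lintegral_sampleLawOn hF ((measurable_sampleRatio hF hG).pow_const 2)]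
  have hpt : ∀ w, ENNReal.ofReal (F w) * sampleRatio F G (w, true) ^ 2 +
      ENNReal.ofReal (1 - F w) * sampleRatio F G (w, false) ^ 2 ≤
      1 + (Set.Icc u v).indicator (fun _ => ENNReal.ofReal (B ^ 2 / q)) w := by
    intro w
    have h0 := (hF01 w).1
    have h1 : 0 < 1 - F w := sub_pos.2 (hF01 w).2
    have hG0 := (hG01 w).1
    have hG1 : 0 ≤ 1 - G w := sub_nonneg.2 (hG01 w).2
    simp only [sampleRatio, if_true, Bool.false_eq_true, if_false]
    rw [← ENNReal.ofReal_pow (by positivity), ← ENNReal.ofReal_pow (by positivity),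
      ← ENNReal.ofReal_mul h0.le, ← ENNReal.ofReal_mul h1.le,
      ← ENNReal.ofReal_add (by positivity) (by positivity)]
    have hid : F w * (G w / F w) ^ 2 + (1 - F w) * ((1 - G w) / (1 - F w)) ^ 2 =
        1 + (G w - F w) ^ 2 / (F w * (1 - F w)) := by
      field_simp
      ring
    rw [hid]
    by_cases hw : w ∈ Set.Icc u v
    · rw [Set.indicator_of_mem hw, ← ENNReal.ofReal_one,
        ← ENNReal.ofReal_add zero_le_one (by positivity)]
      refine ENNReal.ofReal_le_ofReal (add_le_add le_rfl ?_)
      exact div_le_div₀ (sq_nonneg _) (sq_le_sq' (neg_le_of_abs_le (hB w))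
        (le_of_abs_le (hB w))) hq (hFq w)
    · simp [hout w hw]
  have h_int : ∫⁻ w in Set.Icc a b,
      (Set.Icc u v).indicator (fun _ => ENNReal.ofReal (B ^ 2 / q)) w ≤
      ENNReal.ofReal (B ^ 2 / q * (v - u)) := by
    calc _ ≤ ∫⁻ w, (Set.Icc u v).indicator (fun _ => ENNReal.ofReal (B ^ 2 / q)) w :=
          setLIntegral_le_lintegral _ _
      _ = _ := by
        rw [lintegral_indicator measurableSet_Icc, setLIntegral_const, Real.volume_Icc,
          ENNReal.ofReal_mul (by positivity)]
  have hone : 1 ≤ ENNReal.ofReal (b - a) := ENNReal.one_le_ofReal.2 hab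
  calc _ ≤ (ENNReal.ofReal (b - a))⁻¹ * ∫⁻ w in Set.Icc a b,
        (1 + (Set.Icc u v).indicator (fun _ => ENNReal.ofReal (B ^ 2 / q)) w) := by
        exact mul_le_mul' le_rfl (lintegral_mono hpt)
    _ = (ENNReal.ofReal (b - a))⁻¹ * (ENNReal.ofReal (b - a) + ∫⁻ w in Set.Icc a b,
        (Set.Icc u v).indicator (fun _ => ENNReal.ofReal (B ^ 2 / q)) w) := by
        rw [lintegral_add_left measurable_const]
        simp
    _ ≤ (ENNReal.ofReal (b - a))⁻¹ * ENNReal.ofReal (b - a) +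
        1 * ENNReal.ofReal (B ^ 2 / q * (v - u)) := by
        rw [mul_add]
        gcongr
        exact ENNReal.inv_le_one.2 hone
    _ = _ := by
        rw [ENNReal.inv_mul_cancel (zero_lt_one.trans_le hone).ne' (by finiteness), one_mul]

theorem one_add_ofReal_pow_le_two {x : ℝ} {n : ℕ} (hx : 0 ≤ x) (hnx : n * x ≤ 1 / 2) :
    (1 + ENNReal.ofReal x) ^ n ≤ 2 := by
  have h : (1 + x) ^ n ≤ 2 := by
    calc (1 + x) ^ n ≤ Real.exp x ^ n := by
          gcongr
          linarith [Real.add_one_le_exp x]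
      _ = Real.exp (n * x) := (Real.exp_nat_mul x n).symm
      _ ≤ Real.exp (1 / 2) := Real.exp_le_exp.2 hnx
      _ ≤ 2 := by
          have h1 : Real.exp (1 / 2) ^ 2 = Real.exp 1 := by
            rw [← Real.exp_nat_mul]; norm_num
          nlinarith [Real.exp_one_lt_d9, Real.exp_pos (1 / 2)]
  rw [← ENNReal.ofReal_one, ← ENNReal.ofReal_add zero_le_one hx,
    ← ENNReal.ofReal_pow (by positivity)]
  simpa using ENNReal.ofReal_le_ofReal h

/-- The odd function `sign u * min (a * |u| ^ p) b`. -/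
noncomputable def truncPow (a b p u : ℝ) : ℝ :=
  min (a * max u 0 ^ p) b - min (a * max (-u) 0 ^ p) b

section TruncPow

variable {a b p : ℝ}

theorem truncPow_neg (u : ℝ) : truncPow a b p (-u) = -truncPow a b p u := by
  simp [truncPow]

theorem truncPow_of_nonneg (hb : 0 < b) (hp : 0 < p) {u : ℝ} (hu : 0 ≤ u) :
    truncPow a b p u = min (a * u ^ p) b := by
  simp [truncPow, hu, Real.zero_rpow hp.ne', hb.le]

theorem truncPow_of_nonpos (hb : 0 < b) (hp : 0 < p) {u : ℝ} (hu : u ≤ 0) :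
    truncPow a b p u = -min (a * (-u) ^ p) b := by
  rw [← truncPow_of_nonneg hb hp (neg_nonneg.2 hu), truncPow_neg, neg_neg]

theorem abs_truncPow (ha : 0 < a) (hb : 0 < b) (hp : 0 < p) (u : ℝ) :
    |truncPow a b p u| = min (a * |u| ^ p) b := by
  rcases le_total 0 u with hu | hu
  · rw [truncPow_of_nonneg hb hp hu, abs_of_nonneg hu, abs_of_nonneg (by positivity)]
  · have := neg_nonneg.2 hu
    rw [truncPow_of_nonpos hb hp hu, abs_of_nonpos hu, abs_neg, abs_of_nonneg (by positivity)]

theorem truncPow_pos (ha : 0 < a) (hb : 0 < b) (hp : 0 < p) {u : ℝ} (hu : 0 < u) :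
    0 < truncPow a b p u := by
  rw [truncPow_of_nonneg hb hp hu.le]
  positivity

theorem truncPow_neg_of_neg (ha : 0 < a) (hb : 0 < b) (hp : 0 < p) {u : ℝ} (hu : u < 0) :
    truncPow a b p u < 0 := by
  have := truncPow_pos ha hb hp (neg_pos.2 hu)
  rw [truncPow_neg] at this
  linarith

theorem continuous_truncPow (hp : 0 < p) : Continuous (truncPow a b p) := by
  unfold truncPow
  have : ∀ f : ℝ → ℝ, Continuous f → Continuous fun u => f u ^ p := fun f hf =>
    hf.rpow_const fun _ => Or.inr hp.le
  have h1 := this (fun u => max u 0) (by fun_prop)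
  have h2 := this (fun u => max (-u) 0) (by fun_prop)
  fun_prop

theorem monotone_truncPow (ha : 0 < a) (hp : 0 < p) : Monotone (truncPow a b p) := by
  intro u v huv
  unfold truncPow
  gcongr

end TruncPow

/-- Regression function with threshold `δ`: a truncated odd power centred at `δ` on
`[δ - σ, δ + σ]` and centred at `0` elsewhere. -/
noncomputable def localShift (a b p σ δ x : ℝ) : ℝ :=
  1 / 2 + if |x - δ| ≤ σ then truncPow a b p (x - δ) else truncPow a b p x

section LocalShift

variable {a b p σ δ : ℝ}

theorem measurable_localShift (hp : 0 < p) : Measurable (localShift a b p σ δ) := by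
  have h := (continuous_truncPow (a := a) (b := b) hp).measurable
  refine measurable_const.add (Measurable.ite ?_ (h.comp (by fun_prop)) h)
  exact measurableSet_le (by fun_prop) measurable_const

theorem abs_localShift_le (ha : 0 < a) (hb : 0 < b) (hp : 0 < p) (x : ℝ) :
    |localShift a b p σ δ x - 1 / 2| ≤ b := by
  rw [localShift, add_sub_cancel_left]
  split_ifs <;> rw [abs_truncPow ha hb hp] <;> exact min_le_right _ _

theorem intervalIntegrable_localShift (ha : 0 < a) (hb : 0 < b) (hp : 0 < p) (u v : ℝ) :
    IntervalIntegrable (localShift a b p σ δ) volume u v := by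
  refine (intervalIntegrable_const (c := 1 / 2 + b)).mono_fun
    (measurable_localShift hp).aestronglyMeasurable (Filter.Eventually.of_forall fun x => ?_)
  have := abs_le.1 (abs_localShift_le (σ := σ) (δ := δ) ha hb hp x)
  simp only [Real.norm_eq_abs]
  rw [abs_of_nonneg (by positivity : 0 ≤ 1 / 2 + b), abs_le]
  constructor <;> linarith

theorem localShift_zero : localShift a b p σ 0 = fun x => 1 / 2 + truncPow a b p x := by
  ext x
  simp [localShift]

theorem memClass_localShift {c C k ε₀ η : ℝ} (hk : 1 < k) (ha : 0 < a)
    (hε₀ : 0 < ε₀) (hb : ε₀ < b) (hb' : b < 1 / 2) (hη : η < 1) (hca : c ≤ a)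
    (haC : a ≤ C) (hcη : c ≤ a * (1 - η) ^ (k - 1)) (hCη : a * (1 + η) ^ (k - 1) ≤ C)
    (hσ : 0 < σ) (hσ' : σ ≤ 1 / 4) (hδ : 0 ≤ δ) (hδη : δ ≤ η * σ) :
    memClass c C k σ ε₀ (localShift a b (k - 1) σ δ) δ := by
  have hp : 0 < k - 1 := sub_pos.2 hk
  have hb0 : 0 < b := hε₀.trans hb
  have hδσ : δ < σ := hδη.trans_lt (by nlinarith)
  have hη0 : 0 ≤ η := by
    by_contra h
    nlinarith [not_le.1 h]
  refine ⟨measurable_localShift hp, fun x _ => ?_, ⟨by linarith, by linarith⟩, fun x _ hx => ?_,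
    fun x _ hx => ?_, fun x _ hx => ?_, fun d hd => ?_⟩
  · have := abs_le.1 (abs_localShift_le (σ := σ) (δ := δ) ha hb0 hp x)
    constructor <;> linarith
  · unfold localShift
    split_ifs with h
    · linarith [truncPow_neg_of_neg ha hb0 hp (sub_neg.2 hx)]
    · rw [abs_of_neg (sub_neg.2 hx)] at h
      linarith [truncPow_neg_of_neg ha hb0 hp (u := x) (by linarith)]
  · unfold localShift
    split_ifs with h
    · linarith [truncPow_pos ha hb0 hp (sub_pos.2 hx)]
    · linarith [truncPow_pos ha hb0 hp (u := x) (by linarith)]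
  · rw [localShift, add_sub_cancel_left] at hx ⊢
    split_ifs at hx ⊢ with h
    · rw [abs_truncPow ha hb0 hp] at hx ⊢
      have hle : a * |x - δ| ^ (k - 1) ≤ b := by
        by_contra h'
        rw [min_eq_right (not_le.1 h').le] at hx
        linarith
      rw [min_eq_left hle]
      constructor <;> gcongr
    · rw [abs_truncPow ha hb0 hp] at hx ⊢
      have hle : a * |x| ^ (k - 1) ≤ b := by
        by_contra h'
        rw [min_eq_right (not_le.1 h').le] at hx
        linarith
      rw [min_eq_left hle]
      have hδx : δ ≤ η * |x - δ| := hδη.trans (by gcongr; exact (not_le.1 h).le)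
      have h1 : |x| ≤ (1 + η) * |x - δ| := by
        have := abs_add_le (x - δ) δ
        rw [sub_add_cancel, abs_of_nonneg hδ] at this
        linarith
      have h2 : (1 - η) * |x - δ| ≤ |x| := by
        have := abs_sub x δ
        rw [abs_of_nonneg hδ] at this
        linarith
      have h0 : 0 ≤ 1 - η := by linarith
      constructor
      · calc c * |x - δ| ^ (k - 1) ≤ a * (1 - η) ^ (k - 1) * |x - δ| ^ (k - 1) := by gcongr
          _ = a * ((1 - η) * |x - δ|) ^ (k - 1) := by
            rw [Real.mul_rpow h0 (abs_nonneg _), mul_assoc]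
          _ ≤ _ := by gcongr
      · calc a * |x| ^ (k - 1) ≤ a * ((1 + η) * |x - δ|) ^ (k - 1) := by gcongr
          _ = a * (1 + η) ^ (k - 1) * |x - δ| ^ (k - 1) := by
            rw [Real.mul_rpow (by linarith) (abs_nonneg _), mul_assoc]
          _ ≤ _ := by gcongr
  · have h1 : |δ + d - δ| ≤ σ := by
      rw [add_sub_cancel_left, abs_of_nonneg hd.1]
      exact hd.2
    have h2 : |δ - d - δ| ≤ σ := by
      rw [sub_sub_cancel_left, abs_neg, abs_of_nonneg hd.1]
      exact hd.2
    rw [localShift, localShift, if_pos h1, if_pos h2, add_sub_cancel_left δ,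
      sub_sub_cancel_left, truncPow_neg]
    ring

theorem localShift_zero_sub_localShift (x : ℝ) :
    localShift a b p σ 0 x - localShift a b p σ δ x = (Set.Icc (δ - σ) (δ + σ)).indicator
      (fun x => truncPow a b p x - truncPow a b p (x - δ)) x := by
  have hiff : |x - δ| ≤ σ ↔ x ∈ Set.Icc (δ - σ) (δ + σ) := by
    rw [abs_sub_le_iff, Set.mem_Icc]
    constructor <;> rintro ⟨h1, h2⟩ <;> constructor <;> linarith
  rw [localShift_zero, localShift, Set.indicator_apply]
  simp only [hiff]
  split_ifs <;> ring

theorem integral_truncPow_sub_le (ha : 0 < a) (hb : 0 < b) (hp : 0 < p) (hδ : 0 ≤ δ)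
    (hδσ : δ ≤ σ) :
    ∫ x in (δ - σ)..(δ + σ), (truncPow a b p x - truncPow a b p (x - δ)) ≤
      2 * (a * (2 * σ) ^ p * δ) := by
  have hcont := continuous_truncPow (a := a) (b := b) hp
  have hi : ∀ u v, IntervalIntegrable (truncPow a b p) volume u v :=
    fun u v => hcont.intervalIntegrable u v
  have hbd : ∀ u, |u| ≤ 2 * σ → ‖truncPow a b p u‖ ≤ a * (2 * σ) ^ p := fun u hu => by
    rw [Real.norm_eq_abs, abs_truncPow ha hb hp]
    exact (min_le_left _ _).trans (by gcongr)
  have hi' : IntervalIntegrable (fun x => truncPow a b p (x - δ)) volume (δ - σ) (δ + σ) :=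
    (hcont.comp (continuous_sub_right δ)).intervalIntegrable _ _
  rw [intervalIntegral.integral_sub (hi _ _) hi',
    intervalIntegral.integral_comp_sub_right (fun x => truncPow a b p x),
    intervalIntegral.integral_interval_sub_interval_comm (hi _ _) (hi _ _) (hi _ _)]
  have h1 := intervalIntegral.norm_integral_le_of_norm_le_const (f := truncPow a b p)
    (a := δ - σ) (b := δ - σ - δ) (C := a * (2 * σ) ^ p) fun x hx => hbd x (by
      rw [Set.uIoc_of_ge (by linarith), Set.mem_Ioc] at hx
      rw [abs_le]; constructor <;> linarith)
  have h2 := intervalIntegral.norm_integral_le_of_norm_le_const (f := truncPow a b p)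
    (a := δ + σ) (b := δ + σ - δ) (C := a * (2 * σ) ^ p) fun x hx => hbd x (by
      rw [Set.uIoc_of_ge (by linarith), Set.mem_Ioc] at hx
      rw [abs_le]; constructor <;> linarith)
  rw [sub_sub_cancel_left (δ - σ), abs_neg, abs_of_nonneg hδ, Real.norm_eq_abs] at h1
  rw [sub_sub_cancel_left (δ + σ), abs_neg, abs_of_nonneg hδ, Real.norm_eq_abs] at h2
  linarith [le_of_abs_le h1, neg_le_of_abs_le h2]

theorem measurable_unifConv_localShift (ha : 0 < a) (hb : 0 < b) (hp : 0 < p) :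
    Measurable (unifConv σ (localShift a b p σ δ)) := by
  have hi := intervalIntegrable_localShift (σ := σ) (δ := δ) ha hb hp
  have hc := intervalIntegral.continuous_primitive hi 0
  have : unifConv σ (localShift a b p σ δ) = fun w => 1 / (2 * σ) *
      ((∫ x in (0 : ℝ)..(w + σ), localShift a b p σ δ x) -
        ∫ x in (0 : ℝ)..(w - σ), localShift a b p σ δ x) := by
    ext w
    rw [unifConv, intervalIntegral.integral_interval_sub_left (hi _ _) (hi _ _)]
  rw [this]
  have h1 := hc.comp (continuous_add_const σ)
  have h2 := hc.comp (continuous_sub_right σ)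
  exact (continuous_const.mul (h1.sub h2)).measurable

theorem abs_unifConv_localShift_le (ha : 0 < a) (hb : 0 < b) (hp : 0 < p) (hσ : 0 < σ) (w : ℝ) :
    |unifConv σ (localShift a b p σ δ) w - 1 / 2| ≤ b := by
  have hi := intervalIntegrable_localShift (σ := σ) (δ := δ) ha hb hp (w - σ) (w + σ)
  have h1 := intervalIntegral.norm_integral_le_of_norm_le_const (a := w - σ) (b := w + σ)
    (f := fun x => localShift a b p σ δ x - 1 / 2)
    fun x _ => abs_localShift_le (σ := σ) (δ := δ) ha hb hp x
  rw [intervalIntegral.integral_sub hi intervalIntegrable_const,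
    intervalIntegral.integral_const, Real.norm_eq_abs, smul_eq_mul,
    show w + σ - (w - σ) = 2 * σ by ring, abs_of_pos (by positivity : 0 < 2 * σ)] at h1
  have : unifConv σ (localShift a b p σ δ) w - 1 / 2 =
      (1 / (2 * σ)) * ((∫ x in (w - σ)..(w + σ), localShift a b p σ δ x) - 2 * σ * (1 / 2)) := by
    rw [unifConv]
    field_simp
  rw [this, abs_mul, abs_of_pos (by positivity), one_div_mul_eq_div, div_le_iff₀ (by positivity)]
  exact h1

theorem unifConv_localShift_zero_sub (ha : 0 < a) (hb : 0 < b) (hp : 0 < p) (w : ℝ) :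
    unifConv σ (localShift a b p σ 0) w - unifConv σ (localShift a b p σ δ) w =
      1 / (2 * σ) * ∫ x in (w - σ)..(w + σ), (Set.Icc (δ - σ) (δ + σ)).indicator
        (fun x => truncPow a b p x - truncPow a b p (x - δ)) x := by
  simp only [unifConv, ← localShift_zero_sub_localShift]
  rw [intervalIntegral.integral_sub (intervalIntegrable_localShift ha hb hp _ _)
    (intervalIntegrable_localShift ha hb hp _ _)]
  ring

theorem abs_unifConv_localShift_sub_le (ha : 0 < a) (hb : 0 < b) (hp : 0 < p) (hσ : 0 < σ)
    (hδ : 0 ≤ δ) (hδσ : δ ≤ σ) (w : ℝ) :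
    |unifConv σ (localShift a b p σ δ) w - unifConv σ (localShift a b p σ 0) w| ≤
      a * (2 * σ) ^ p * δ / σ := by
  set f := (Set.Icc (δ - σ) (δ + σ)).indicator
    (fun x => truncPow a b p x - truncPow a b p (x - δ)) with hf
  have hf0 : ∀ x, 0 ≤ f x := fun x => Set.indicator_nonneg
    (fun x _ => sub_nonneg.2 (monotone_truncPow ha hp (by linarith))) x
  have hcont : Continuous fun x => truncPow a b p x - truncPow a b p (x - δ) :=
    (continuous_truncPow hp).sub ((continuous_truncPow hp).comp (continuous_sub_right δ))
  have h_int : Integrable f :=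
    (integrable_indicator_iff measurableSet_Icc).2 hcont.integrableOn_Icc
  have hle : ∫ x in (w - σ)..(w + σ), f x ≤ 2 * (a * (2 * σ) ^ p * δ) := by
    calc ∫ x in (w - σ)..(w + σ), f x = ∫ x in Set.Ioc (w - σ) (w + σ), f x :=
          intervalIntegral.integral_of_le (by linarith)
      _ ≤ ∫ x, f x := setIntegral_le_integral h_int (Filter.Eventually.of_forall hf0)
      _ = ∫ x in (δ - σ)..(δ + σ), (truncPow a b p x - truncPow a b p (x - δ)) := by
          rw [hf, integral_indicator measurableSet_Icc, integral_Icc_eq_integral_Ioc,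
            intervalIntegral.integral_of_le (by linarith)]
      _ ≤ _ := integral_truncPow_sub_le ha hb hp hδ hδσ
  have hnn : 0 ≤ ∫ x in (w - σ)..(w + σ), f x :=
    intervalIntegral.integral_nonneg (by linarith) fun x _ => hf0 x
  rw [abs_sub_comm, unifConv_localShift_zero_sub ha hb hp, ← hf, abs_of_nonneg (by positivity),
    one_div_mul_eq_div, div_le_div_iff₀ (by positivity) hσ]
  nlinarith

theorem unifConv_localShift_eq (ha : 0 < a) (hb : 0 < b) (hp : 0 < p) (hσ : 0 < σ) {w : ℝ}
    (hw : w ∉ Set.Icc (δ - 2 * σ) (δ + 2 * σ)) :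
    unifConv σ (localShift a b p σ δ) w = unifConv σ (localShift a b p σ 0) w := by
  refine (sub_eq_zero.1 ?_).symm
  rw [unifConv_localShift_zero_sub ha hb hp, intervalIntegral.integral_congr (g := fun _ => 0)]
  · simp
  · intro x hx
    rw [Set.uIcc_of_le (by linarith)] at hx
    refine Set.indicator_of_notMem (fun hx' => hw ?_) _
    exact ⟨by linarith [hx.2, hx'.1], by linarith [hx.1, hx'.2]⟩

end LocalShift

theorem exists_ratio_margin {c a C : ℝ} (hca : c < a) (haC : a < C) (p : ℝ) :
    ∃ η : ℝ, 0 < η ∧ η < 1 ∧ c ≤ a * (1 - η) ^ p ∧ a * (1 + η) ^ p ≤ C := by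
  have h1 : ContinuousAt (fun x : ℝ => a * (1 - x) ^ p) 0 :=
    continuousAt_const.mul ((by fun_prop : ContinuousAt (fun x : ℝ => 1 - x) 0).rpow_const
      (Or.inl (by norm_num)))
  have h2 : ContinuousAt (fun x : ℝ => a * (1 + x) ^ p) 0 :=
    continuousAt_const.mul ((by fun_prop : ContinuousAt (fun x : ℝ => 1 + x) 0).rpow_const
      (Or.inl (by norm_num)))
  have e1 := h1.eventually (lt_mem_nhds (by simpa using hca : c < a * (1 - (0 : ℝ)) ^ p))
  have e2 := h2.eventually (gt_mem_nhds (by simpa using haC : a * (1 + (0 : ℝ)) ^ p < C))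
  have e3 : ∀ᶠ x : ℝ in nhds 0, x < 1 := gt_mem_nhds one_pos
  obtain ⟨η, ⟨h1, h2, h3⟩, h4⟩ :=
    (((e1.and (e2.and e3)).filter_mono nhdsWithin_le_nhds).and
      (self_mem_nhdsWithin (s := Set.Ioi (0 : ℝ)))).exists
  exact ⟨η, h4, h3, h1.le, h2.le⟩

theorem unifConv_localShift_two_point {a b p σ δ : ℝ} (ha : 0 < a) (hb : 0 < b) (hb' : b < 1 / 2)
    (hp : 0 < p) (hσ : 0 < σ) (hσ' : σ ≤ 1 / 4) (hδ : 0 ≤ δ) (hδσ : δ ≤ σ) {n : ℕ}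
    (hn : n * ((a * (2 * σ) ^ p * δ / σ) ^ 2 / (1 / 4 - b ^ 2) * (4 * σ)) ≤ 1 / 2)
    {T : (Fin n → ℝ × Bool) → ℝ} (hT : Measurable T) :
    ENNReal.ofReal (δ / 2) ≤
      ∫⁻ x, ENNReal.ofReal |T x - 0| ∂(Measure.pi fun _ : Fin n =>
        sampleLawOn (-1 + σ) (1 - σ) (unifConv σ (localShift a b p σ 0))) +
      ∫⁻ x, ENNReal.ofReal |T x - δ| ∂(Measure.pi fun _ : Fin n =>
        sampleLawOn (-1 + σ) (1 - σ) (unifConv σ (localShift a b p σ δ))) := by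
  have hq : 0 < 1 / 4 - b ^ 2 := by nlinarith
  have hab : 1 ≤ 1 - σ - (-1 + σ) := by linarith
  have hm : ∀ s, Measurable (unifConv σ (localShift a b p σ s)) := fun s =>
    measurable_unifConv_localShift ha hb hp
  have habs : ∀ s w, |unifConv σ (localShift a b p σ s) w - 1 / 2| ≤ b := fun s w =>
    abs_unifConv_localShift_le ha hb hp hσ w
  have hIoo : ∀ s w, unifConv σ (localShift a b p σ s) w ∈ Set.Ioo (0 : ℝ) 1 := fun s w => by
    have := abs_le.1 (habs s w)
    constructor <;> linarith
  have hprob : ∀ s, IsProbabilityMeasure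
      (sampleLawOn (-1 + σ) (1 - σ) (unifConv σ (localShift a b p σ s))) := fun s =>
    isProbabilityMeasure_sampleLawOn (by linarith) (hm s) fun w => Set.Ioo_subset_Icc_self (hIoo s w)
  have hchi := lintegral_sampleRatio_sq_le hab (hm 0) (hm δ) hq (hIoo 0)
    (fun w => Set.Ioo_subset_Icc_self (hIoo δ w))
    (fun w => by
      have := sq_le_sq' (neg_le_of_abs_le (habs 0 w)) (le_of_abs_le (habs 0 w))
      nlinarith)
    (abs_unifConv_localShift_sub_le ha hb hp hσ hδ hδσ)
    (fun w hw => unifConv_localShift_eq ha hb hp hσ hw)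
  rw [show δ + 2 * σ - (δ - 2 * σ) = 4 * σ by ring] at hchi
  have hpow := (pow_le_pow_left₀ zero_le hchi n).trans
    (one_add_ofReal_pow_le_two (by positivity) hn)
  have := two_point_lower_bound _ _ (measurable_sampleRatio (hm 0) (hm δ))
    (sampleLawOn_eq_withDensity (hm 0) (hm δ) (hIoo 0)) n hpow hT 0 δ
  rwa [sub_zero, abs_of_nonneg hδ] at this

theorem separation_le {k κ σ x : ℝ} (hk : 1 < k) (hκ : 0 ≤ κ) (hx : 0 < x)
    (hσ : x ^ (-(1 / (2 * k - 1))) ≤ σ) :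
    κ * σ ^ (-(k - 3 / 2)) * x ^ (-(1 / 2) : ℝ) ≤ κ * σ := by
  have hσ0 : 0 < σ := (Real.rpow_pos_of_pos hx _).trans_le hσ
  have h : x ^ (-(1 / 2) : ℝ) ≤ σ ^ (k - 1 / 2) := by
    calc x ^ (-(1 / 2) : ℝ) = (x ^ (-(1 / (2 * k - 1)))) ^ (k - 1 / 2) := by
          rw [← Real.rpow_mul hx.le]
          congr 1
          have : 2 * k - 1 ≠ 0 := by linarith
          field_simp
      _ ≤ _ := Real.rpow_le_rpow (by positivity) hσ (by linarith)
  calc κ * σ ^ (-(k - 3 / 2)) * x ^ (-(1 / 2) : ℝ)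
      ≤ κ * σ ^ (-(k - 3 / 2)) * σ ^ (k - 1 / 2) := by gcongr
    _ = κ * σ := by
      rw [mul_assoc, ← Real.rpow_add hσ0, show -(k - 3 / 2) + (k - 1 / 2) = 1 by ring,
        Real.rpow_one]

theorem separation_divergence {k κ σ x a q : ℝ} (hx : 0 < x) (hσ : 0 < σ) :
    x * ((a * (2 * σ) ^ (k - 1) * (κ * σ ^ (-(k - 3 / 2)) * x ^ (-(1 / 2) : ℝ)) / σ) ^ 2 / q *
      (4 * σ)) = 4 * (a * 2 ^ (k - 1) * κ) ^ 2 / q := by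
  have h1 : x * (x ^ (-(1 / 2) : ℝ)) ^ 2 = 1 := by
    rw [← Real.rpow_natCast, ← Real.rpow_mul hx.le]
    norm_num
    rw [Real.rpow_neg_one, mul_inv_cancel₀ hx.ne']
  have h2 : (σ ^ (k - 1) * σ ^ (-(k - 3 / 2))) ^ 2 = σ := by
    rw [← Real.rpow_add hσ, ← Real.rpow_natCast, ← Real.rpow_mul hσ.le]
    rw [show (k - 1 + -(k - 3 / 2)) * ((2 : ℕ) : ℝ) = 1 by push_cast; ring, Real.rpow_one]
  rw [Real.mul_rpow two_pos.le hσ.le]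
  calc _ = (x * (x ^ (-(1 / 2) : ℝ)) ^ 2) * (σ ^ (k - 1) * σ ^ (-(k - 3 / 2))) ^ 2 * (σ / σ ^ 2) *
        (4 * (a * 2 ^ (k - 1) * κ) ^ 2 / q) := by ring
    _ = _ := by
      rw [h1, h2]
      field_simp

/-- Passive minimax lower bound, general `k`, large noise: for
`κ₀ n^{-1/(2k-1)} ≤ σ ≤ ρ`, every estimator based on `n` i.i.d. passive samples
(with `W` uniform on `[-1+σ, 1-σ]` and labels from the convolved regression function)
has worst-case point error at least `κ₁ σ^{-(k-3/2)} n^{-1/2}` over `𝒫(c,C,k,σ)`. -/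
theorem passive_lower_bound_general_k_large_noise (k c C ε₀ : ℝ) (hk : 1 < k)
    (hc : 0 < c) (hcC : c < C) (hC : C ≤ 1) (hε₀ : ε₀ ∈ Set.Ioo (0 : ℝ) (1 / 2)) :
    ∃ κ₀ κ₁ ρ : ℝ, 0 < κ₀ ∧ 0 < κ₁ ∧ ρ ∈ Set.Ioo (0 : ℝ) (1 / 2) ∧
      ∀ n : ℕ, 1 ≤ n → ∀ σ : ℝ, κ₀ * (n : ℝ) ^ (-(1 / (2 * k - 1))) ≤ σ → σ ≤ ρ →
        ∀ that : (Fin n → ℝ × Bool) → ℝ, Measurable that →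
          ENNReal.ofReal (κ₁ * σ ^ (-(k - 3 / 2)) * (n : ℝ) ^ (-(1 / 2) : ℝ)) ≤
            ⨆ (m : ℝ → ℝ) (t : ℝ) (_ : memClass c C k σ ε₀ m t),
              ∫⁻ x, ENNReal.ofReal |that x - t|
                ∂(Measure.pi fun _ : Fin n =>
                    sampleLawOn (-1 + σ) (1 - σ) (unifConv σ m)) := by
  obtain ⟨η, hη0, hη1, hcη, hCη⟩ := exists_ratio_margin (c := c) (a := (c + C) / 2) (C := C)
    (by linarith) (by linarith) (k - 1)
  obtain ⟨hε0, hε1⟩ := hε₀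
  set a := (c + C) / 2 with ha
  set b := (1 / 2 + ε₀) / 2 with hb
  have ha0 : 0 < a := by linarith
  have hb0 : 0 < b := by linarith
  have hb1 : b < 1 / 2 := by linarith
  have hq : 0 < 1 / 4 - b ^ 2 := by nlinarith
  set κ := min η (√(1 / 4 - b ^ 2) / (4 * (a * 2 ^ (k - 1)))) with hκ
  have hκ0 : 0 < κ := lt_min hη0 (by positivity)
  refine ⟨1, κ / 4, 1 / 4, one_pos, by positivity, ⟨by norm_num, by norm_num⟩, ?_⟩
  intro n hn σ hσ hσ' T hT
  have hn0 : (0 : ℝ) < n := by exact_mod_cast hn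
  rw [one_mul] at hσ
  have hσ0 : 0 < σ := (Real.rpow_pos_of_pos hn0 _).trans_le hσ
  set δ := κ * σ ^ (-(k - 3 / 2)) * (n : ℝ) ^ (-(1 / 2) : ℝ) with hδ
  have hδ0 : 0 ≤ δ := by positivity
  have hδη : δ ≤ η * σ := (separation_le hk hκ0.le hn0 hσ).trans
    (mul_le_mul_of_nonneg_right (min_le_left _ _) hσ0.le)
  have hdiv : n * ((a * (2 * σ) ^ (k - 1) * δ / σ) ^ 2 / (1 / 4 - b ^ 2) * (4 * σ)) ≤ 1 / 2 := by
    rw [hδ, separation_divergence hn0 hσ0, div_le_iff₀ hq]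
    have h1 : a * 2 ^ (k - 1) * κ ≤ √(1 / 4 - b ^ 2) / 4 := by
      have := (le_div_iff₀ (by positivity)).1 (min_le_right η (√(1 / 4 - b ^ 2) /
        (4 * (a * 2 ^ (k - 1)))))
      linarith
    have h2 := pow_le_pow_left₀ (by positivity) h1 2
    rw [div_pow, Real.sq_sqrt hq.le] at h2
    linarith
  have hmem : ∀ s, 0 ≤ s → s ≤ η * σ → memClass c C k σ ε₀ (localShift a b (k - 1) σ s) s :=
    fun s hs hs' => memClass_localShift hk ha0 hε0 (by linarith) hb1 hη1 (by linarith)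
      (by linarith) hcη hCη hσ0 hσ' hs hs'
  have key := unifConv_localShift_two_point ha0 hb0 hb1 (sub_pos.2 hk) hσ0 hσ' hδ0
    (hδη.trans (by nlinarith)) hdiv hT
  set S := ⨆ (m : ℝ → ℝ) (t : ℝ) (_ : memClass c C k σ ε₀ m t),
    ∫⁻ x, ENNReal.ofReal |T x - t|
      ∂(Measure.pi fun _ : Fin n => sampleLawOn (-1 + σ) (1 - σ) (unifConv σ m)) with hS
  have hle : ∀ s, 0 ≤ s → s ≤ η * σ → ∫⁻ x, ENNReal.ofReal |T x - s|
      ∂(Measure.pi fun _ : Fin n =>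
        sampleLawOn (-1 + σ) (1 - σ) (unifConv σ (localShift a b (k - 1) σ s))) ≤ S :=
    fun s hs hs' => le_iSup_of_le _ (le_iSup_of_le s (le_iSup_of_le (hmem s hs hs') le_rfl))
  have h2S := key.trans (add_le_add (hle 0 le_rfl (by positivity)) (hle δ hδ0 hδη))
  rw [show δ / 2 = δ / 4 + δ / 4 by ring, ENNReal.ofReal_add (by positivity) (by positivity)] at h2S
  rw [show κ / 4 * σ ^ (-(k - 3 / 2)) * (n : ℝ) ^ (-(1 / 2) : ℝ) = δ / 4 by rw [hδ]; ring]
  exact not_lt.1 fun h => (ENNReal.add_lt_add h h).not_ge h2S
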